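/- For all propositional formulas α, β and γ, the formula [α]⟨β⟩γ ↔ (Eα → ((E(α∧β) ∧ ⟨α∧β⟩γ) ∨ (¬E(α∧β) ∧ E(β∧γ)))) is valid in ConWON. -/

import Mathlib

open Classical in
/-- Greedy intersection: keep intersecting with successive defaults as long as nonempty. -/
noncomputable def eAux {W : Type*} : Set W → List (Set W) → Set W
  | A, [] => A
  | A, E :: rest => if (A ∩ E).Nonempty then eAux (A ∩ E) rest else A

/-- Expected states of a context (list of defaults). -/
noncomputable def expect {W : Type*} : List (Set W) → Set W
  | [] => Set.univ
  | D :: rest => eAux D rest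

/-- Propositional formulas over a countable set of atoms (identified with ℕ). -/
inductive PForm : Type
  | atom : ℕ → PForm
  | fls : PForm
  | neg : PForm → PForm
  | conj : PForm → PForm → PForm

/-- The language ConWON: propositional connectives plus the conditional [α]φ
with propositional antecedent. -/
inductive Form : Type
  | atom : ℕ → Form
  | fls : Form
  | neg : Form → Form
  | conj : Form → Form → Form
  | cond : PForm → Form → Form

/-- Extension ⟦α⟧ of a propositional formula in a model (W, V). -/
def pval {W : Type*} (V : ℕ → Set W) : PForm → Set W
  | .atom n => V n
  | .fls => ∅
  | .neg a => (pval V a)ᶜ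
  | .conj a b => pval V a ∩ pval V b

/-- Truth at a contextualized pointed model: M,C,w ⊨ φ. -/
def sat {W : Type*} (V : ℕ → Set W) : List (Set W) → W → Form → Prop
  | _, w, .atom n => w ∈ V n
  | _, _, .fls => False
  | C, w, .neg φ => ¬ sat V C w φ
  | C, w, .conj φ ψ => sat V C w φ ∧ sat V C w ψ
  | C, _, .cond α φ => ∀ u ∈ expect (pval V α :: C), sat V (pval V α :: C) u φ

universe u

/-- Validity in ConWON: truth at every contextualized pointed model. -/
def valid (φ : Form) : Prop :=
  ∀ (W : Type u) (_ : Nonempty W) (V : ℕ → Set W) (C : List (Set W)),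
    C ≠ [] → ∀ w : W, sat V C w φ

def Form.top : Form := .neg .fls
def Form.or (φ ψ : Form) : Form := .neg (.conj (.neg φ) (.neg ψ))
def Form.imp (φ ψ : Form) : Form := .neg (.conj φ (.neg ψ))
def Form.iff (φ ψ : Form) : Form := .conj (.imp φ ψ) (.imp ψ φ)
/-- ⟨α⟩φ := ¬[α]¬φ. -/
def Form.dia (α : PForm) (φ : Form) : Form := .neg (.cond α (.neg φ))
/-- Eα := ⟨α⟩⊤. -/
def Form.E (α : PForm) : Form := Form.dia α Form.top
/-- Aα := ¬E¬α. -/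
def Form.A (α : PForm) : Form := .neg (Form.E (.neg α))
def PForm.imp (a b : PForm) : PForm := .neg (.conj a (.neg b))

/-- Embedding of propositional formulas into ConWON. -/
def pToForm : PForm → Form
  | .atom n => .atom n
  | .fls => .fls
  | .neg a => .neg (pToForm a)
  | .conj a b => .conj (pToForm a) (pToForm b)

/-- Closed formulas: χ ::= [α]φ | ¬χ | (χ∧χ). -/
inductive Closed : Form → Prop
  | cond (α : PForm) (φ : Form) : Closed (.cond α φ)
  | neg {χ : Form} : Closed χ → Closed (.neg χ)
  | conj {χ₁ χ₂ : Form} : Closed χ₁ → Closed χ₂ → Closed (.conj χ₁ χ₂)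

/-- Conditional-free formulas of ConWON. -/
def CondFree : Form → Prop
  | .atom _ => True
  | .fls => True
  | .neg φ => CondFree φ
  | .conj φ ψ => CondFree φ ∧ CondFree ψ
  | .cond _ _ => False

/-- The flat fragment ConWON-1: no conditional occurs inside another conditional. -/
def Flat : Form → Prop
  | .atom _ => True
  | .fls => True
  | .neg φ => Flat φ
  | .conj φ ψ => Flat φ ∧ Flat ψ
  | .cond _ φ => CondFree φ

theorem eAux_nonempty_iff {W : Type*} (L : List (Set W)) (A : Set W) :
    (eAux A L).Nonempty ↔ A.Nonempty := by
  induction L generalizing A with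
  | nil => rfl
  | cons E rest ih =>
    unfold eAux
    split_ifs with h
    · exact (ih _).trans ⟨fun h => h.left, fun _ => h⟩
    · rfl

theorem sat_pToForm {W : Type*} (V : ℕ → Set W) (C : List (Set W)) (w : W) (a : PForm) :
    sat V C w (pToForm a) ↔ w ∈ pval V a := by
  induction a with
  | atom n => simp [pToForm, sat, pval]
  | fls => simp [pToForm, sat, pval]
  | neg a ih => simp [pToForm, sat, pval, ih]
  | conj a b iha ihb => simp [pToForm, sat, pval, iha, ihb]

theorem sat_imp {W : Type*} (V : ℕ → Set W) (C : List (Set W)) (w : W) (φ ψ : Form) :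
    sat V C w (Form.imp φ ψ) ↔ (sat V C w φ → sat V C w ψ) := by
  simp [Form.imp, sat]

theorem sat_iff {W : Type*} (V : ℕ → Set W) (C : List (Set W)) (w : W) (φ ψ : Form) :
    sat V C w (Form.iff φ ψ) ↔ (sat V C w φ ↔ sat V C w ψ) := by
  rw [Form.iff, sat, sat_imp, sat_imp]
  exact iff_def.symm

theorem sat_or {W : Type*} (V : ℕ → Set W) (C : List (Set W)) (w : W) (φ ψ : Form) :
    sat V C w (Form.or φ ψ) ↔ (sat V C w φ ∨ sat V C w ψ) := by
  simp only [Form.or, sat]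
  tauto

theorem sat_dia_pToForm {W : Type*} (V : ℕ → Set W) (C : List (Set W)) (w : W) (a c : PForm) :
    sat V C w (Form.dia a (pToForm c)) ↔ (eAux (pval V a) C ∩ pval V c).Nonempty := by
  simp [Form.dia, sat, expect, sat_pToForm, Set.Nonempty]

theorem sat_E {W : Type*} (V : ℕ → Set W) (C : List (Set W)) (w : W) (a : PForm) :
    sat V C w (Form.E a) ↔ (pval V a).Nonempty := by
  rw [← eAux_nonempty_iff C]
  simp [Form.E, Form.dia, Form.top, sat, expect, Set.Nonempty]

/-- [α]⟨β⟩γ ↔ (Eα → ((E(α∧β) ∧ ⟨α∧β⟩γ) ∨ (¬E(α∧β) ∧ E(β∧γ)))) is valid in ConWON. -/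
theorem valid_cond_dia (α β γ : PForm) :
    valid (Form.iff (.cond α (Form.dia β (pToForm γ)))
      (Form.imp (Form.E α)
        (Form.or
          (Form.conj (Form.E (.conj α β)) (Form.dia (.conj α β) (pToForm γ)))
          (Form.conj (.neg (Form.E (.conj α β))) (Form.E (.conj β γ)))))) := by
  intro W _ V C _ w
  simp only [sat_iff, sat_imp, sat_or, sat_E, sat, sat_dia_pToForm, expect, pval]
  have hα : (∀ u ∈ eAux (pval V α) C,
      (eAux (pval V β) (pval V α :: C) ∩ pval V γ).Nonempty) ↔
      ((pval V α).Nonempty → (eAux (pval V β) (pval V α :: C) ∩ pval V γ).Nonempty) := by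
    rw [← eAux_nonempty_iff C (pval V α)]
    exact ⟨fun h ⟨u, hu⟩ => h u hu, fun h u hu => h ⟨u, hu⟩⟩
  rw [hα, eAux, Set.inter_comm (pval V β) (pval V α)]
  split_ifs with h <;> simp [h]
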